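/- Let E and F be finite-dimensional real inner product spaces and 0 < c ≤ C. For each s ≥ 0 let V_s : E × F → ℝ satisfy c(1 + cs)^{−1} I_E ⊕ c I_F ≤ HV_s ≤ C(1 + Cs)^{−1} I_E ⊕ C I_F. For s, t ∈ [0, ∞), suppose F_{s,t} : E × F → E satisfies F_{t,t}(x, y) = x and ∂_s F_{s,t}(x, y) = (1/2) ∇_x V_s(F_{s,t}(x, y), y) for all (x, y). Then: (i) ‖F_{s,t}‖_{Lip,dx} ≤ ((1+Cs)/(1+Ct))^{1/2} when s ≥ t, and ‖F_{s,t}‖_{Lip,dx} ≤ ((1+cs)/(1+ct))^{1/2} when s ≤ t; (ii) ‖F_{s,t}‖_{Lip,dy} ≤ (C/c − 1)(1+Cs)^{1/2}((1+Ct)^{−1/2} − (1+Cs)^{−1/2}) when s ≥ t, and ‖F_{s,t}‖_{Lip,dy} ≤ (C/c − 1)(1+cs)^{1/2}((1+Cs)^{−1/2} − (1+Ct)^{−1/2}) when s ≤ t. -/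

import Mathlib

open Set
open scoped RealInnerProductSpace Topology

/-- A convex function on a finite-dimensional space has a subgradient at every point. -/
theorem ConvexOn.exists_subgradient {G : Type*} [NormedAddCommGroup G] [NormedSpace ℝ G]
    [FiniteDimensional ℝ G] {f : G → ℝ} (hf : ConvexOn ℝ univ f) (x : G) :
    ∃ l : G →L[ℝ] ℝ, ∀ y, f x + l (y - x) ≤ f y := by
  have hcont : Continuous f := hf.locallyLipschitz.continuous
  have hconv : Convex ℝ {p : G × ℝ | f p.1 < p.2} := by
    simpa using hf.convex_strict_epigraph
  have hopen : IsOpen {p : G × ℝ | f p.1 < p.2} :=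
    isOpen_lt (hcont.comp continuous_fst) continuous_snd
  obtain ⟨L, hL⟩ := geometric_hahn_banach_open_point (x := (x, f x)) hconv hopen (by simp)
  have hsplit : ∀ (y : G) (r : ℝ), L (y, r) = L (y, 0) + r * L (0, 1) := by
    intro y r
    have : (y, r) = (y, (0 : ℝ)) + r • ((0 : G), (1 : ℝ)) := by simp
    rw [this, map_add, map_smul, smul_eq_mul]
  have hneg : L (0, 1) < 0 := by
    have h := hL (x, f x + 1) (by simp)
    rw [hsplit x (f x + 1), hsplit x (f x)] at h
    linarith
  have hk : 0 < -(L (0, 1)) := by linarith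
  refine ⟨(-(L (0, 1)))⁻¹ • L.comp (ContinuousLinearMap.inl ℝ G ℝ), fun y => ?_⟩
  have hle : L (y, f y) ≤ L (x, f x) := by
    refine le_of_forall_pos_le_add fun ε hε => ?_
    have h := hL (y, f y + ε / (-(L (0, 1)))) (lt_add_of_pos_right _ (div_pos hε hk))
    rw [hsplit] at h
    rw [hsplit y (f y)]
    have : ε / (-(L (0, 1))) * L (0, 1) = -ε := by
      rw [div_neg, neg_mul, div_mul_cancel₀ _ hneg.ne]
    linarith
  rw [hsplit, hsplit x] at hle
  have hsub : L (y - x, 0) = L (y, 0) - L (x, 0) := by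
    rw [← map_sub]; simp
  have : (-(L (0, 1)))⁻¹ * (L (y, 0) - L (x, 0)) ≤ f y - f x := by
    rw [inv_mul_le_iff₀ hk]
    linarith
  simp only [smul_apply, ContinuousLinearMap.comp_apply,
    ContinuousLinearMap.inl_apply, smul_eq_mul, hsub]
  linarith

section Quadratic

variable {E F : Type*}
  [NormedAddCommGroup E] [InnerProductSpace ℝ E] [FiniteDimensional ℝ E]
  [NormedAddCommGroup F] [InnerProductSpace ℝ F] [FiniteDimensional ℝ F]

/-- A function that is convex up to a quadratic form has quadratic minorants touching it. -/
theorem ConvexOn.exists_quadratic_minorant {W : E × F → ℝ} {α β : ℝ}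
    (hW : ConvexOn ℝ univ (fun p : E × F => W p - α * ‖p.1‖ ^ 2 - β * ‖p.2‖ ^ 2)) (p : E × F) :
    ∃ L : E × F →L[ℝ] ℝ, ∀ d : E × F,
      W p + L d + α * ‖d.1‖ ^ 2 + β * ‖d.2‖ ^ 2 ≤ W (p + d) := by
  obtain ⟨l, hl⟩ := hW.exists_subgradient p
  refine ⟨l + (2 * α) • (innerSL ℝ p.1).comp (ContinuousLinearMap.fst ℝ E F)
    + (2 * β) • (innerSL ℝ p.2).comp (ContinuousLinearMap.snd ℝ E F), fun d => ?_⟩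
  have h := hl (p + d)
  simp only [add_sub_cancel_left, Prod.fst_add, Prod.snd_add, norm_add_sq_real] at h
  simp only [add_apply, smul_apply,
    ContinuousLinearMap.comp_apply, innerSL_apply_apply, ContinuousLinearMap.coe_fst',
    ContinuousLinearMap.coe_snd', smul_eq_mul]
  linarith

/-- Under two-sided quadratic bounds, the lower and upper linear approximations agree. -/
theorem exists_quadratic_approximation {W : E × F → ℝ} {α β α' β' : ℝ}
    (hconv : ConvexOn ℝ univ (fun p : E × F => W p - α * ‖p.1‖ ^ 2 - β * ‖p.2‖ ^ 2))
    (hconc : ConcaveOn ℝ univ (fun p : E × F => W p - α' * ‖p.1‖ ^ 2 - β' * ‖p.2‖ ^ 2))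
    (p : E × F) :
    ∃ L : E × F →L[ℝ] ℝ, ∀ d : E × F,
      W p + L d + α * ‖d.1‖ ^ 2 + β * ‖d.2‖ ^ 2 ≤ W (p + d) ∧
      W (p + d) ≤ W p + L d + α' * ‖d.1‖ ^ 2 + β' * ‖d.2‖ ^ 2 := by
  obtain ⟨L, hL⟩ := hconv.exists_quadratic_minorant p
  have hconv' : ConvexOn ℝ univ
      (fun p : E × F => (-W) p - (-α') * ‖p.1‖ ^ 2 - (-β') * ‖p.2‖ ^ 2) := by
    have hneg : (fun p : E × F => (-W) p - (-α') * ‖p.1‖ ^ 2 - (-β') * ‖p.2‖ ^ 2) =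
        -fun p : E × F => W p - α' * ‖p.1‖ ^ 2 - β' * ‖p.2‖ ^ 2 := by
      ext q
      simp only [Pi.neg_apply]
      ring
    rw [hneg]
    exact hconc.neg
  obtain ⟨M, hM⟩ := hconv'.exists_quadratic_minorant p
  have key : ∀ d, L d + M d ≤ 0 := by
    intro d
    have hle : ∀ t : ℝ, 0 < t → L d + M d ≤
        t * ((α' - α) * ‖d.1‖ ^ 2 + (β' - β) * ‖d.2‖ ^ 2) := by
      intro t ht
      have h1 := hL (t • d)
      have h2 := hM (t • d)
      simp only [Pi.neg_apply, map_smul, smul_eq_mul, Prod.smul_fst, Prod.smul_snd, norm_smul,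
        mul_pow, Real.norm_eq_abs, sq_abs] at h1 h2
      refine le_of_mul_le_mul_left ?_ ht
      linarith
    have hlim : Filter.Tendsto
        (fun t : ℝ => t * ((α' - α) * ‖d.1‖ ^ 2 + (β' - β) * ‖d.2‖ ^ 2)) (𝓝[>] 0) (𝓝 0) := by
      have : Continuous fun t : ℝ => t * ((α' - α) * ‖d.1‖ ^ 2 + (β' - β) * ‖d.2‖ ^ 2) := by
        fun_prop
      simpa using (this.tendsto 0).mono_left nhdsWithin_le_nhds
    exact ge_of_tendsto hlim (Filter.eventually_of_mem self_mem_nhdsWithin hle)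
  have hLM : ∀ d, M d = -L d := by
    intro d
    have h1 := key d
    have h2 := key (-d)
    simp only [map_neg] at h2
    linarith
  refine ⟨L, fun d => ⟨hL d, ?_⟩⟩
  have h := hM d
  rw [hLM] at h
  simp only [Pi.neg_apply] at h
  linarith

/-- Quadratic upper and lower bounds expressed with the partial gradient in the first variable. -/
theorem exists_quadratic_approximation_gradient {W : E × F → ℝ} {α β α' β' : ℝ}
    (hconv : ConvexOn ℝ univ (fun p : E × F => W p - α * ‖p.1‖ ^ 2 - β * ‖p.2‖ ^ 2))
    (hconc : ConcaveOn ℝ univ (fun p : E × F => W p - α' * ‖p.1‖ ^ 2 - β' * ‖p.2‖ ^ 2))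
    (x : E) (y : F) :
    ∃ m : F →L[ℝ] ℝ, ∀ (h : E) (k : F),
      W (x, y) + ⟪gradient (fun a => W (a, y)) x, h⟫ + m k + α * ‖h‖ ^ 2 + β * ‖k‖ ^ 2
        ≤ W (x + h, y + k) ∧
      W (x + h, y + k) ≤
        W (x, y) + ⟪gradient (fun a => W (a, y)) x, h⟫ + m k + α' * ‖h‖ ^ 2 + β' * ‖k‖ ^ 2 := by
  obtain ⟨L, hL⟩ := exists_quadratic_approximation hconv hconc (x, y)
  have hsplit : ∀ h k, L (h, k) = L (h, 0) + L (0, k) := by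
    intro h k
    rw [← map_add]; simp
  have hO : (fun a => W (a, y) - (W (x, y) + L.comp (ContinuousLinearMap.inl ℝ E F) (a - x)))
      =O[𝓝 x] fun a => ‖a - x‖ ^ 2 := by
    refine Asymptotics.IsBigO.of_bound (max |α| |α'|) (Filter.Eventually.of_forall fun a => ?_)
    obtain ⟨h1, h2⟩ := hL (a - x, 0)
    simp only [Prod.mk_add_mk, add_sub_cancel, add_zero, norm_zero] at h1 h2
    simp only [ContinuousLinearMap.comp_apply, ContinuousLinearMap.inl_apply]
    rw [Real.norm_eq_abs, Real.norm_of_nonneg (by positivity), abs_le]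
    have hα : -(max |α| |α'|) ≤ α := by
      linarith [neg_abs_le α, le_max_left |α| |α'|]
    have hα' : α' ≤ max |α| |α'| := (le_abs_self α').trans (le_max_right _ _)
    have := mul_le_mul_of_nonneg_right hα (sq_nonneg ‖a - x‖)
    have := mul_le_mul_of_nonneg_right hα' (sq_nonneg ‖a - x‖)
    constructor <;> linarith
  have hd : HasFDerivAt (fun a => W (a, y)) (L.comp (ContinuousLinearMap.inl ℝ E F)) x := by
    have h0 := hO.hasFDerivAt (𝕜 := ℝ) one_lt_two
    have h1 : HasFDerivAt
        (fun a => W (x, y) + L.comp (ContinuousLinearMap.inl ℝ E F) (a - x))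
        (L.comp (ContinuousLinearMap.inl ℝ E F)) x :=
      ((L.comp (ContinuousLinearMap.inl ℝ E F)).hasFDerivAt.comp x
        ((hasFDerivAt_id x).sub_const x)).const_add _
    have h2 := h0.add h1
    rw [zero_add] at h2
    exact h2.congr_of_eventuallyEq (Filter.Eventually.of_forall fun a => by simp)
  have hgrad : ∀ h, ⟪gradient (fun a => W (a, y)) x, h⟫ = L (h, 0) := by
    intro h
    rw [(hasFDerivAt_iff_hasGradientAt.1 hd).gradient, InnerProductSpace.toDual_symm_apply]
    simp
  refine ⟨L.comp (ContinuousLinearMap.inr ℝ E F), fun h k => ?_⟩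
  obtain ⟨h1, h2⟩ := hL (h, k)
  rw [hsplit] at h1 h2
  simp only [Prod.mk_add_mk] at h1 h2
  simp only [hgrad, ContinuousLinearMap.comp_apply, ContinuousLinearMap.inr_apply]
  constructor <;> linarith

/-- The partial gradient is strongly monotone in the first variable. -/
theorem le_inner_gradient_sub {W : E × F → ℝ} {α β α' β' : ℝ}
    (hconv : ConvexOn ℝ univ (fun p : E × F => W p - α * ‖p.1‖ ^ 2 - β * ‖p.2‖ ^ 2))
    (hconc : ConcaveOn ℝ univ (fun p : E × F => W p - α' * ‖p.1‖ ^ 2 - β' * ‖p.2‖ ^ 2))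
    (x x' : E) (y : F) :
    2 * α * ‖x - x'‖ ^ 2 ≤
      ⟪x - x', gradient (fun a => W (a, y)) x - gradient (fun a => W (a, y)) x'⟫ := by
  obtain ⟨m, hm⟩ := exists_quadratic_approximation_gradient hconv hconc x y
  obtain ⟨m', hm'⟩ := exists_quadratic_approximation_gradient hconv hconc x' y
  have h := (hm (x' - x) 0).1
  have h' := (hm' (x - x') 0).1
  rw [← neg_sub x x', inner_neg_right, norm_neg, neg_sub] at h
  simp only [add_sub_cancel, add_zero, map_zero, norm_zero] at h h'
  rw [real_inner_comm, inner_sub_left]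
  linarith

/-- The partial gradient is one-sided Lipschitz in the first variable. -/
theorem inner_gradient_sub_le {W : E × F → ℝ} {α β α' β' : ℝ}
    (hconv : ConvexOn ℝ univ (fun p : E × F => W p - α * ‖p.1‖ ^ 2 - β * ‖p.2‖ ^ 2))
    (hconc : ConcaveOn ℝ univ (fun p : E × F => W p - α' * ‖p.1‖ ^ 2 - β' * ‖p.2‖ ^ 2))
    (x x' : E) (y : F) :
    ⟪x - x', gradient (fun a => W (a, y)) x - gradient (fun a => W (a, y)) x'⟫ ≤
      2 * α' * ‖x - x'‖ ^ 2 := by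
  obtain ⟨m, hm⟩ := exists_quadratic_approximation_gradient hconv hconc x y
  obtain ⟨m', hm'⟩ := exists_quadratic_approximation_gradient hconv hconc x' y
  have h := (hm (x' - x) 0).2
  have h' := (hm' (x - x') 0).2
  rw [← neg_sub x x', inner_neg_right, norm_neg, neg_sub] at h
  simp only [add_sub_cancel, add_zero, map_zero, norm_zero] at h h'
  rw [real_inner_comm, inner_sub_left]
  linarith

/-- The partial gradient in the first variable is Lipschitz in the second variable. -/
theorem norm_gradient_sub_sq_le {W : E × F → ℝ} {α β α' β' : ℝ} (hα : α ≤ α') (hβ : β ≤ β')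
    (hconv : ConvexOn ℝ univ (fun p : E × F => W p - α * ‖p.1‖ ^ 2 - β * ‖p.2‖ ^ 2))
    (hconc : ConcaveOn ℝ univ (fun p : E × F => W p - α' * ‖p.1‖ ^ 2 - β' * ‖p.2‖ ^ 2))
    (x : E) (y y' : F) :
    ‖gradient (fun a => W (a, y)) x - gradient (fun a => W (a, y')) x‖ ^ 2 ≤
      4 * (α' - α) * (β' - β) * ‖y - y'‖ ^ 2 := by
  obtain ⟨m, hm⟩ := exists_quadratic_approximation_gradient hconv hconc x y
  obtain ⟨m', hm'⟩ := exists_quadratic_approximation_gradient hconv hconc x y'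
  set w := gradient (fun a => W (a, y)) x - gradient (fun a => W (a, y')) x with hw
  have key : ∀ t : ℝ, 0 ≤ (α' - α) * ‖w‖ ^ 2 * (t * t) + (-‖w‖ ^ 2) * t
      + (β' - β) * ‖y - y'‖ ^ 2 := by
    intro t
    have h1 := (hm (t • w) (y' - y)).1
    have h2 := (hm' (t • w) 0).2
    have h3 := (hm 0 (y' - y)).2
    rw [norm_sub_rev y' y] at h1 h3
    simp only [add_sub_cancel, add_zero, map_zero, norm_zero, inner_zero_right, norm_smul,
      mul_pow, Real.norm_eq_abs, sq_abs, inner_smul_right] at h1 h2 h3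
    have h4 : ‖w‖ ^ 2 = ⟪gradient (fun a => W (a, y)) x, w⟫
        - ⟪gradient (fun a => W (a, y')) x, w⟫ := by
      rw [← inner_sub_left, ← hw, real_inner_self_eq_norm_sq]
    have h5 : t * ‖w‖ ^ 2 = t * ⟪gradient (fun a => W (a, y)) x, w⟫
        - t * ⟪gradient (fun a => W (a, y')) x, w⟫ := by
      rw [h4]; ring
    linarith
  have hdis := discrim_le_zero key
  rw [discrim] at hdis
  rcases (sq_nonneg ‖w‖).eq_or_lt with h0 | hpos
  · rw [← h0]
    have := sub_nonneg.2 hα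
    have := sub_nonneg.2 hβ
    positivity
  · refine le_of_mul_le_mul_left ?_ hpos
    linarith

end Quadratic

section Comparison

variable {E : Type*} [NormedAddCommGroup E]

theorem sqrt_norm_sq_add_le (v : E) {ε : ℝ} (hε : 0 < ε) : √(‖v‖ ^ 2 + ε ^ 2) ≤ ‖v‖ + ε := by
  rw [Real.sqrt_le_left (by positivity)]
  nlinarith [norm_nonneg v]

theorem norm_le_sqrt_norm_sq_add (v : E) (ε : ℝ) : ‖v‖ ≤ √(‖v‖ ^ 2 + ε ^ 2) :=
  Real.le_sqrt_of_sq_le (by nlinarith)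

variable [InnerProductSpace ℝ E]

theorem hasDerivWithinAt_sqrt_norm_sq_add {u : ℝ → E} {u' : E} {S : Set ℝ} {s ε : ℝ} (hε : 0 < ε)
    (hu : HasDerivWithinAt u u' S s) :
    HasDerivWithinAt (fun r => √(‖u r‖ ^ 2 + ε ^ 2)) (⟪u s, u'⟫ / √(‖u s‖ ^ 2 + ε ^ 2)) S s := by
  have h := (hu.norm_sq.add_const (ε ^ 2)).sqrt (by positivity)
  convert h using 1
  field_simp

/-- If the radial velocity of `u` is at most `h'`, then `‖u‖ - h` is antitone. -/
theorem antitoneOn_norm_sub {u u' : ℝ → E} {h h' : ℝ → ℝ}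
    (hu : ∀ s ∈ Ici (0 : ℝ), HasDerivWithinAt u (u' s) (Ici 0) s)
    (hh : ∀ s ∈ Ici (0 : ℝ), HasDerivWithinAt h (h' s) (Ici 0) s)
    (hh' : ∀ s ∈ Ici (0 : ℝ), 0 ≤ h' s)
    (hle : ∀ s ∈ Ici (0 : ℝ), ⟪u s, u' s⟫ ≤ h' s * ‖u s‖) :
    AntitoneOn (fun s => ‖u s‖ - h s) (Ici 0) := by
  intro s hs t ht hst
  refine le_of_forall_pos_le_add fun ε hε => ?_
  have hd : ∀ r ∈ Ici (0 : ℝ), HasDerivWithinAt (fun r => √(‖u r‖ ^ 2 + ε ^ 2) - h r)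
      (⟪u r, u' r⟫ / √(‖u r‖ ^ 2 + ε ^ 2) - h' r) (Ici 0) r := fun r hr =>
    (hasDerivWithinAt_sqrt_norm_sq_add hε (hu r hr)).sub (hh r hr)
  have hanti : AntitoneOn (fun r => √(‖u r‖ ^ 2 + ε ^ 2) - h r) (Ici 0) := by
    refine antitoneOn_of_hasDerivWithinAt_nonpos (convex_Ici 0)
      (fun r hr => (hd r hr).continuousWithinAt)
      (fun r hr => (hd r (interior_subset hr)).mono interior_subset) fun r hr => ?_
    have hr := interior_subset hr
    rw [sub_nonpos, div_le_iff₀ (by positivity)]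
    exact (hle r hr).trans
      (mul_le_mul_of_nonneg_left (norm_le_sqrt_norm_sq_add _ _) (hh' r hr))
  have h1 := hanti hs ht hst
  have h2 := norm_le_sqrt_norm_sq_add (u t) ε
  have h3 := sqrt_norm_sq_add_le (u s) hε
  dsimp only at h1 ⊢
  linarith

/-- If the radial velocity of `u` is at least `-h'`, then `‖u‖ + h` is monotone. -/
theorem monotoneOn_norm_add {u u' : ℝ → E} {h h' : ℝ → ℝ}
    (hu : ∀ s ∈ Ici (0 : ℝ), HasDerivWithinAt u (u' s) (Ici 0) s)
    (hh : ∀ s ∈ Ici (0 : ℝ), HasDerivWithinAt h (h' s) (Ici 0) s)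
    (hh' : ∀ s ∈ Ici (0 : ℝ), 0 ≤ h' s)
    (hle : ∀ s ∈ Ici (0 : ℝ), -(h' s * ‖u s‖) ≤ ⟪u s, u' s⟫) :
    MonotoneOn (fun s => ‖u s‖ + h s) (Ici 0) := by
  intro s hs t ht hst
  refine le_of_forall_pos_le_add fun ε hε => ?_
  have hd : ∀ r ∈ Ici (0 : ℝ), HasDerivWithinAt (fun r => √(‖u r‖ ^ 2 + ε ^ 2) + h r)
      (⟪u r, u' r⟫ / √(‖u r‖ ^ 2 + ε ^ 2) + h' r) (Ici 0) r := fun r hr =>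
    (hasDerivWithinAt_sqrt_norm_sq_add hε (hu r hr)).add (hh r hr)
  have hmono : MonotoneOn (fun r => √(‖u r‖ ^ 2 + ε ^ 2) + h r) (Ici 0) := by
    refine monotoneOn_of_hasDerivWithinAt_nonneg (convex_Ici 0)
      (fun r hr => (hd r hr).continuousWithinAt)
      (fun r hr => (hd r (interior_subset hr)).mono interior_subset) fun r hr => ?_
    have hr := interior_subset hr
    rw [← neg_le_iff_add_nonneg, le_div_iff₀ (by positivity)]
    have := mul_le_mul_of_nonneg_left (norm_le_sqrt_norm_sq_add (u r) ε) (hh' r hr)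
    linarith [hle r hr]
  have h1 := hmono hs ht hst
  have h2 := norm_le_sqrt_norm_sq_add (u s) ε
  have h3 := sqrt_norm_sq_add_le (u t) hε
  dsimp only at h1 ⊢
  linarith

theorem inv_sqrt_sq {κ s : ℝ} (hκ : 0 < κ) (hs : 0 ≤ s) : (√(1 + κ * s))⁻¹ ^ 2 = (1 + κ * s)⁻¹ := by
  rw [inv_pow, Real.sq_sqrt (by positivity)]

theorem hasDerivAt_inv_sqrt {κ s : ℝ} (hκ : 0 < κ) (hs : 0 ≤ s) :
    HasDerivAt (fun r => (√(1 + κ * r))⁻¹) (-(κ / 2) * (√(1 + κ * s))⁻¹ ^ 3) s := by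
  have hpos : 0 < 1 + κ * s := by positivity
  have h1 : HasDerivAt (fun r => 1 + κ * r) κ s := by
    simpa using ((hasDerivAt_id s).const_mul κ).const_add 1
  have hsq : 0 < √(1 + κ * s) := Real.sqrt_pos.2 hpos
  refine ((h1.sqrt hpos.ne').inv hsq.ne').congr_deriv ?_
  field_simp

theorem inner_inv_sqrt_smul {κ s : ℝ} (v w : E) :
    ⟪(√(1 + κ * s))⁻¹ • v, (√(1 + κ * s))⁻¹ • w + (-(κ / 2) * (√(1 + κ * s))⁻¹ ^ 3) • v⟫ =
      (√(1 + κ * s))⁻¹ ^ 2 * (⟪v, w⟫ - κ / 2 * (√(1 + κ * s))⁻¹ ^ 2 * ‖v‖ ^ 2) := by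
  simp only [inner_add_right, inner_smul_left, inner_smul_right, real_inner_self_eq_norm_sq,
    RCLike.conj_to_real]
  ring

/-- Forward comparison for a curve growing at most like `√(1 + κ s)` up to a forcing term `η`. -/
theorem antitoneOn_inv_sqrt_mul_norm_sub {X X' : ℝ → E} {h h' η : ℝ → ℝ} {κ : ℝ} (hκ : 0 < κ)
    (hX : ∀ s ∈ Ici (0 : ℝ), HasDerivWithinAt X (X' s) (Ici 0) s)
    (hh : ∀ s ∈ Ici (0 : ℝ), HasDerivWithinAt h (h' s) (Ici 0) s)
    (hh' : ∀ s ∈ Ici (0 : ℝ), 0 ≤ h' s)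
    (hη : ∀ s ∈ Ici (0 : ℝ), (√(1 + κ * s))⁻¹ * η s ≤ h' s)
    (hle : ∀ s ∈ Ici (0 : ℝ),
      ⟪X s, X' s⟫ ≤ κ / 2 * (√(1 + κ * s))⁻¹ ^ 2 * ‖X s‖ ^ 2 + η s * ‖X s‖) :
    AntitoneOn (fun s => (√(1 + κ * s))⁻¹ * ‖X s‖ - h s) (Ici 0) := by
  have hnorm : ∀ s, ‖(√(1 + κ * s))⁻¹ • X s‖ = (√(1 + κ * s))⁻¹ * ‖X s‖ := fun s => by
    rw [norm_smul, Real.norm_of_nonneg (by positivity)]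
  have := antitoneOn_norm_sub (u := fun s => (√(1 + κ * s))⁻¹ • X s)
    (fun s hs => (hasDerivAt_inv_sqrt hκ hs).hasDerivWithinAt.smul (hX s hs)) hh hh' ?_
  · simpa only [hnorm] using this
  · intro s hs
    rw [inner_inv_sqrt_smul, hnorm]
    set r := (√(1 + κ * s))⁻¹
    have hr : 0 ≤ r := by positivity
    have h1 := mul_le_mul_of_nonneg_left (hle s hs) (sq_nonneg r)
    have h2 := mul_le_mul_of_nonneg_right (hη s hs) (mul_nonneg hr (norm_nonneg (X s)))
    linarith

/-- Backward comparison for a curve growing at least like `√(1 + κ s)` up to a forcing term `η`. -/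
theorem monotoneOn_inv_sqrt_mul_norm_add {X X' : ℝ → E} {h h' η : ℝ → ℝ} {κ : ℝ} (hκ : 0 < κ)
    (hX : ∀ s ∈ Ici (0 : ℝ), HasDerivWithinAt X (X' s) (Ici 0) s)
    (hh : ∀ s ∈ Ici (0 : ℝ), HasDerivWithinAt h (h' s) (Ici 0) s)
    (hh' : ∀ s ∈ Ici (0 : ℝ), 0 ≤ h' s)
    (hη : ∀ s ∈ Ici (0 : ℝ), (√(1 + κ * s))⁻¹ * η s ≤ h' s)
    (hle : ∀ s ∈ Ici (0 : ℝ),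
      κ / 2 * (√(1 + κ * s))⁻¹ ^ 2 * ‖X s‖ ^ 2 - η s * ‖X s‖ ≤ ⟪X s, X' s⟫) :
    MonotoneOn (fun s => (√(1 + κ * s))⁻¹ * ‖X s‖ + h s) (Ici 0) := by
  have hnorm : ∀ s, ‖(√(1 + κ * s))⁻¹ • X s‖ = (√(1 + κ * s))⁻¹ * ‖X s‖ := fun s => by
    rw [norm_smul, Real.norm_of_nonneg (by positivity)]
  have := monotoneOn_norm_add (u := fun s => (√(1 + κ * s))⁻¹ • X s)
    (fun s hs => (hasDerivAt_inv_sqrt hκ hs).hasDerivWithinAt.smul (hX s hs)) hh hh' ?_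
  · simpa only [hnorm] using this
  · intro s hs
    rw [inner_inv_sqrt_smul, hnorm]
    set r := (√(1 + κ * s))⁻¹
    have hr : 0 ≤ r := by positivity
    have h1 := mul_le_mul_of_nonneg_left (hle s hs) (sq_nonneg r)
    have h2 := mul_le_mul_of_nonneg_right (hη s hs) (mul_nonneg hr (norm_nonneg (X s)))
    linarith

end Comparison

/-- Lipschitz estimates in `x` and in `y` for the transport flow maps
`F_{s,t}` associated to a family of potentials `V_s` satisfying
`c(1+cs)⁻¹ I_E ⊕ c I_F ≤ HV_s ≤ C(1+Cs)⁻¹ I_E ⊕ C I_F`. -/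
theorem stmt15 {E F : Type*}
    [NormedAddCommGroup E] [InnerProductSpace ℝ E] [FiniteDimensional ℝ E]
    [NormedAddCommGroup F] [InnerProductSpace ℝ F] [FiniteDimensional ℝ F]
    (c C : ℝ) (hc : 0 < c) (hcC : c ≤ C)
    (V : ℝ → E × F → ℝ)
    (hconv : ∀ s ∈ Ici (0 : ℝ), ConvexOn ℝ univ
      (fun p : E × F =>
        V s p - c / (2 * (1 + c * s)) * ‖p.1‖ ^ 2 - c / 2 * ‖p.2‖ ^ 2))
    (hconc : ∀ s ∈ Ici (0 : ℝ), ConcaveOn ℝ univ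
      (fun p : E × F =>
        V s p - C / (2 * (1 + C * s)) * ‖p.1‖ ^ 2 - C / 2 * ‖p.2‖ ^ 2))
    (Fmap : ℝ → ℝ → E → F → E)
    (hF0 : ∀ t ∈ Ici (0 : ℝ), ∀ (x : E) (y : F), Fmap t t x y = x)
    (hFode : ∀ t ∈ Ici (0 : ℝ), ∀ (x : E) (y : F), ∀ s ∈ Ici (0 : ℝ),
      HasDerivWithinAt (fun s' => Fmap s' t x y)
        ((1 / 2 : ℝ) • gradient (fun a => V s (a, y)) (Fmap s t x y)) (Ici 0) s) :
    ∀ s ∈ Ici (0 : ℝ), ∀ t ∈ Ici (0 : ℝ),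
      ((t ≤ s → ∀ (y : F) (x x' : E),
        ‖Fmap s t x y - Fmap s t x' y‖ ≤
          Real.sqrt ((1 + C * s) / (1 + C * t)) * ‖x - x'‖) ∧
       (s ≤ t → ∀ (y : F) (x x' : E),
        ‖Fmap s t x y - Fmap s t x' y‖ ≤
          Real.sqrt ((1 + c * s) / (1 + c * t)) * ‖x - x'‖)) ∧
      ((t ≤ s → ∀ (x : E) (y y' : F),
        ‖Fmap s t x y - Fmap s t x y'‖ ≤
          (C / c - 1) * Real.sqrt (1 + C * s) *
            ((Real.sqrt (1 + C * t))⁻¹ - (Real.sqrt (1 + C * s))⁻¹) * ‖y - y'‖) ∧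
       (s ≤ t → ∀ (x : E) (y y' : F),
        ‖Fmap s t x y - Fmap s t x y'‖ ≤
          (C / c - 1) * Real.sqrt (1 + c * s) *
            ((Real.sqrt (1 + C * s))⁻¹ - (Real.sqrt (1 + C * t))⁻¹) * ‖y - y'‖)) := by
  have hC : 0 < C := hc.trans_le hcC
  have hM : 0 ≤ C / c - 1 := by
    rw [sub_nonneg, le_div_iff₀ hc]; linarith
  have hcoef : ∀ (κ s : ℝ), 0 < κ → 0 ≤ s →
      κ * (√(1 + κ * s))⁻¹ ^ 2 = 2 * (κ / (2 * (1 + κ * s))) := by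
    intro κ s hκ hs
    rw [inv_sqrt_sq hκ hs]
    have : 0 < 1 + κ * s := by positivity
    field_simp
  have hrate : ∀ s : ℝ, 0 ≤ s → c * (√(1 + c * s))⁻¹ ^ 2 ≤ C * (√(1 + C * s))⁻¹ ^ 2 := by
    intro s hs
    rw [inv_sqrt_sq hc hs, inv_sqrt_sq hC hs, ← div_eq_mul_inv, ← div_eq_mul_inv,
      div_le_div_iff₀ (by positivity) (by positivity)]
    linarith
  have hrate' : ∀ s : ℝ, 0 ≤ s → c * (√(1 + c * s))⁻¹ ≤ C * (√(1 + C * s))⁻¹ := by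
    intro s hs
    refine le_of_sq_le_sq ?_ (by positivity)
    have h1 := mul_le_mul_of_nonneg_left (hrate s hs) hc.le
    have h2 : c * (C * (√(1 + C * s))⁻¹ ^ 2) ≤ C * (C * (√(1 + C * s))⁻¹ ^ 2) :=
      mul_le_mul_of_nonneg_right hcC (by positivity)
    linarith
  have hup : ∀ s ∈ Ici (0 : ℝ), ∀ (x x' : E) (y : F),
      ⟪x - x', gradient (fun a => V s (a, y)) x - gradient (fun a => V s (a, y)) x'⟫ ≤
        C * (√(1 + C * s))⁻¹ ^ 2 * ‖x - x'‖ ^ 2 := by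
    intro s hs x x' y
    rw [hcoef C s hC hs]
    exact inner_gradient_sub_le (hconv s hs) (hconc s hs) x x' y
  have hlow : ∀ s ∈ Ici (0 : ℝ), ∀ (x x' : E) (y : F),
      c * (√(1 + c * s))⁻¹ ^ 2 * ‖x - x'‖ ^ 2 ≤
      ⟪x - x', gradient (fun a => V s (a, y)) x - gradient (fun a => V s (a, y)) x'⟫ := by
    intro s hs x x' y
    rw [hcoef c s hc hs]
    exact le_inner_gradient_sub (hconv s hs) (hconc s hs) x x' y
  have hcross : ∀ s ∈ Ici (0 : ℝ), ∀ (x : E) (y y' : F),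
      ‖gradient (fun a => V s (a, y)) x - gradient (fun a => V s (a, y')) x‖ ≤
        (C - c) * (√(1 + c * s))⁻¹ * (√(1 + C * s))⁻¹ * ‖y - y'‖ := by
    intro s hs x y y'
    have hs' : 0 ≤ s := hs
    have hCc := sub_nonneg.2 hcC
    refine le_of_sq_le_sq ?_ (by positivity)
    have h1 := hcoef c s hc hs
    have h2 := hcoef C s hC hs
    have h3 := hrate s hs
    have h := norm_gradient_sub_sq_le (by linarith) (by linarith) (hconv s hs) (hconc s hs) x y y'
    refine h.trans_eq ?_
    rw [mul_pow, mul_pow, mul_pow, inv_sqrt_sq hc hs, inv_sqrt_sq hC hs]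
    have : 0 < 1 + c * s := by positivity
    have : 0 < 1 + C * s := by positivity
    field_simp
    ring
  have hcrossInner : ∀ s ∈ Ici (0 : ℝ), ∀ (v x : E) (y y' : F),
      |⟪v, gradient (fun a => V s (a, y)) x - gradient (fun a => V s (a, y')) x⟫| ≤
        (C - c) * (√(1 + c * s))⁻¹ * (√(1 + C * s))⁻¹ * ‖y - y'‖ * ‖v‖ := by
    intro s hs v x y y'
    refine (abs_real_inner_le_norm _ _).trans ?_
    rw [mul_comm]
    exact mul_le_mul_of_nonneg_right (hcross s hs x y y') (norm_nonneg v)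
  have hder : ∀ t ∈ Ici (0 : ℝ), ∀ (x x' : E) (y y' : F), ∀ s ∈ Ici (0 : ℝ),
      HasDerivWithinAt (fun s' => Fmap s' t x y - Fmap s' t x' y')
        ((1 / 2 : ℝ) • (gradient (fun a => V s (a, y)) (Fmap s t x y)
          - gradient (fun a => V s (a, y')) (Fmap s t x' y'))) (Ici 0) s := by
    intro t ht x x' y y' s hs
    rw [smul_sub]
    exact (hFode t ht x y s hs).sub (hFode t ht x' y' s hs)
  have hforce : ∀ y y' : F, ∀ s ∈ Ici (0 : ℝ), HasDerivWithinAt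
      (fun s => -((C / c - 1) * ‖y - y'‖) * (√(1 + C * s))⁻¹)
      (-((C / c - 1) * ‖y - y'‖) * (-(C / 2) * (√(1 + C * s))⁻¹ ^ 3)) (Ici 0) s :=
    fun y y' s hs => ((hasDerivAt_inv_sqrt hC hs).const_mul _).hasDerivWithinAt
  have hforce_nonneg : ∀ y y' : F, ∀ s ∈ Ici (0 : ℝ),
      0 ≤ -((C / c - 1) * ‖y - y'‖) * (-(C / 2) * (√(1 + C * s))⁻¹ ^ 3) := by
    intro y y' s hs
    rw [neg_mul, neg_mul, mul_neg, neg_neg]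
    positivity
  have hMc : (C - c) = (C / c - 1) * c := by field_simp
  have hinner : ∀ s ∈ Ici (0 : ℝ), ∀ (z z' : E) (y y' : F),
      ⟪z - z', (1 / 2 : ℝ) • (gradient (fun a => V s (a, y)) z
          - gradient (fun a => V s (a, y')) z')⟫ =
        1 / 2 * ⟪z - z', gradient (fun a => V s (a, y)) z - gradient (fun a => V s (a, y)) z'⟫
        + 1 / 2 *
          ⟪z - z', gradient (fun a => V s (a, y)) z' - gradient (fun a => V s (a, y')) z'⟫ := by
    intro s hs z z' y y'
    rw [inner_smul_right, ← mul_add, ← inner_add_right, sub_add_sub_cancel]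
  have hsqrt : ∀ κ r : ℝ, 0 < κ → 0 ≤ r → 0 < √(1 + κ * r) := fun κ r hκ hr =>
    Real.sqrt_pos.2 (by positivity)
  intro s hs t ht
  refine ⟨⟨fun hts y x x' => ?_, fun hst y x x' => ?_⟩, fun hts x y y' => ?_, fun hst x y y' => ?_⟩
  · have h := antitoneOn_inv_sqrt_mul_norm_sub (h := 0) (h' := 0) (η := 0) hC
      (hder t ht x x' y y) (fun _ _ => hasDerivWithinAt_const _ _ _) (by simp) (by simp)
      (fun r hr => by
        rw [inner_smul_right]
        have := hup r hr (Fmap r t x y) (Fmap r t x' y) y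
        simp only [Pi.zero_apply]
        linarith) ht hs hts
    simp only [hF0 t ht, Pi.zero_apply, sub_zero] at h
    rw [inv_mul_le_iff₀ (hsqrt C s hC hs)] at h
    rwa [Real.sqrt_div' _ (by have : 0 ≤ t := ht; positivity), div_eq_mul_inv, mul_assoc]
  · have h := monotoneOn_inv_sqrt_mul_norm_add (h := 0) (h' := 0) (η := 0) hc
      (hder t ht x x' y y) (fun _ _ => hasDerivWithinAt_const _ _ _) (by simp) (by simp)
      (fun r hr => by
        rw [inner_smul_right]
        have := hlow r hr (Fmap r t x y) (Fmap r t x' y) y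
        simp only [Pi.zero_apply]
        linarith) hs ht hst
    simp only [hF0 t ht, Pi.zero_apply, add_zero] at h
    rw [inv_mul_le_iff₀ (hsqrt c s hc hs)] at h
    rwa [Real.sqrt_div' _ (by have : 0 ≤ t := ht; positivity), div_eq_mul_inv, mul_assoc]
  · have h := antitoneOn_inv_sqrt_mul_norm_sub
      (η := fun r => 1 / 2 * ((C - c) * (√(1 + c * r))⁻¹ * (√(1 + C * r))⁻¹ * ‖y - y'‖)) hC
      (hder t ht x x y y') (hforce y y') (hforce_nonneg y y')
      (fun r hr => by
        have h1 := mul_le_mul_of_nonneg_left (hrate' r hr)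
          (show 0 ≤ 1 / 2 * (C / c - 1) * ‖y - y'‖ * (√(1 + C * r))⁻¹ ^ 2 by positivity)
        rw [hMc]
        linarith)
      (fun r hr => by
        rw [hinner r hr]
        have h1 := hup r hr (Fmap r t x y) (Fmap r t x y') y
        have h2 := (abs_le.1 (hcrossInner r hr (Fmap r t x y - Fmap r t x y')
          (Fmap r t x y') y y')).2
        linarith) ht hs hts
    simp only [hF0 t ht, sub_self, norm_zero, mul_zero] at h
    have h' : (√(1 + C * s))⁻¹ * ‖Fmap s t x y - Fmap s t x y'‖ ≤
        (C / c - 1) * ‖y - y'‖ * ((√(1 + C * t))⁻¹ - (√(1 + C * s))⁻¹) := by linarith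
    rw [inv_mul_le_iff₀ (hsqrt C s hC hs)] at h'
    linarith
  · have h := monotoneOn_inv_sqrt_mul_norm_add
      (η := fun r => 1 / 2 * ((C - c) * (√(1 + c * r))⁻¹ * (√(1 + C * r))⁻¹ * ‖y - y'‖)) hc
      (hder t ht x x y y') (hforce y y') (hforce_nonneg y y')
      (fun r hr => by
        have h1 := mul_le_mul_of_nonneg_left (hrate r hr)
          (show 0 ≤ 1 / 2 * (C / c - 1) * ‖y - y'‖ * (√(1 + C * r))⁻¹ by positivity)
        rw [hMc]
        linarith)
      (fun r hr => by
        rw [hinner r hr]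
        have h1 := hlow r hr (Fmap r t x y) (Fmap r t x y') y
        have h2 := (abs_le.1 (hcrossInner r hr (Fmap r t x y - Fmap r t x y')
          (Fmap r t x y') y y')).1
        linarith) hs ht hst
    simp only [hF0 t ht, sub_self, norm_zero, mul_zero] at h
    have h' : (√(1 + c * s))⁻¹ * ‖Fmap s t x y - Fmap s t x y'‖ ≤
        (C / c - 1) * ‖y - y'‖ * ((√(1 + C * s))⁻¹ - (√(1 + C * t))⁻¹) := by linarith
    rw [inv_mul_le_iff₀ (hsqrt c s hc hs)] at h'
    linarith
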